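/- Let T be a finite rooted binary tree with leaf assignment χ, and let u be an internal vertex of T with two children v and w. Then H_v ∪ H_w ⊆ H_u ∪ {u} and H_v ∩ H_w ⊆ {u}; consequently |H_u| ≥ |H_v| + |H_w| − 2. -/

import Mathlib

open scoped Classical
noncomputable section

/-- A finite rooted binary tree on vertex set `V`: every non-root vertex has a parent,
the root has none, depths are consistent (ensuring acyclicity), and each vertex has
at most two children. -/
structure RBTree (V : Type) [Fintype V] [DecidableEq V] where
  parent : V → Option V
  root : V
  depth : V → ℕ
  parent_root : parent root = none
  root_of_parent_none : ∀ v, parent v = none → v = root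
  depth_parent : ∀ v u, parent v = some u → depth v = depth u + 1
  binary : ∀ v : V, (Finset.univ.filter (fun c => parent c = some v)).card ≤ 2

namespace RBTree

variable {V : Type} [Fintype V] [DecidableEq V]

/-- The children of a vertex. -/
def children (T : RBTree V) (v : V) : Finset V :=
  Finset.univ.filter (fun c => T.parent c = some v)

/-- A leaf is a vertex with no children. -/
def IsLeaf (T : RBTree V) (v : V) : Prop := T.children v = ∅

/-- Iterated parent map. -/
def parentIter (T : RBTree V) : ℕ → V → Option V
  | 0, v => some v
  | n + 1, v => (T.parentIter n v).bind T.parent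

/-- `u` is a (weak) ancestor of `v`: `u` lies on the path from `v` to the root
(including `v` itself). -/
def Anc (T : RBTree V) (u v : V) : Prop := ∃ n, T.parentIter n v = some u

/-- `u` is a strict ancestor of `v`. -/
def StrictAnc (T : RBTree V) (u v : V) : Prop := ∃ n, 0 < n ∧ T.parentIter n v = some u

/-- `L(T_v)`: the leaves of the subtree rooted at `v`. -/
def subtreeLeaves (T : RBTree V) (v : V) : Finset V :=
  Finset.univ.filter (fun l => T.IsLeaf l ∧ T.Anc v l)

/-- A leaf assignment `χ` assigns to each internal vertex a set of leaves containing
exactly one leaf from the subtree of each of its children (and nothing else);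
leaves are assigned the empty set. -/
structure LeafAssignment (T : RBTree V) where
  χ : V → Finset V
  mem_leaf : ∀ v l, l ∈ χ v → T.IsLeaf l
  mem_desc : ∀ v l, l ∈ χ v → ∃ c ∈ T.children v, T.Anc c l
  unique_child : ∀ v, ∀ c ∈ T.children v, ∃! l, l ∈ χ v ∧ T.Anc c l

/-- The heap `H_v = {u ∈ A(v) : χ(u) ∩ L(T_v) ≠ ∅}` of a vertex `v`. -/
def heap (T : RBTree V) (A : T.LeafAssignment) (v : V) : Finset V :=
  Finset.univ.filter (fun u => T.StrictAnc u v ∧ (A.χ u ∩ T.subtreeLeaves v).Nonempty)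

/-- A leaf path: the set of vertices on a monotone path from some leaf `ℓ` up to an
ancestor `b` of `ℓ`. -/
def IsLeafPath (T : RBTree V) (p : Finset V) : Prop :=
  ∃ ℓ b, T.IsLeaf ℓ ∧ T.Anc b ℓ ∧
    p = Finset.univ.filter (fun u => T.Anc u ℓ ∧ T.Anc b u)

/-- The base `b(p)` of a path: its vertex closest to the root. -/
def base (T : RBTree V) (p : Finset V) : V :=
  if h : ∃ b, b ∈ p ∧ ∀ w ∈ p, T.Anc b w then h.choose else T.root

/-- The leaf `ℓ(p)` of a path. -/
def pathLeaf (T : RBTree V) (p : Finset V) : V :=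
  if h : ∃ l, l ∈ p ∧ ∀ w ∈ p, T.Anc w l then h.choose else T.root

/-- `H_p = H_{b(p)}`. -/
def pathHeap (T : RBTree V) (A : T.LeafAssignment) (p : Finset V) : Finset V :=
  T.heap A (T.base p)

/-- A path decomposition: a partition of the vertex set into leaf paths. -/
def IsPathDecomp (T : RBTree V) (P : Finset (Finset V)) : Prop :=
  (∀ p ∈ P, T.IsLeafPath p) ∧ (∀ v : V, ∃! p, p ∈ P ∧ v ∈ p)

/-- `q` is a child of `p` in the shrub: the parent of `b(q)` lies on `p`. -/
def ShrubParent (T : RBTree V) (p q : Finset V) : Prop :=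
  ∃ u, T.parent (T.base q) = some u ∧ u ∈ p

/-- `p` is a strict ancestor of `q` in the shrub: some vertex of `p` is a strict
ancestor of `b(q)` in `T` (and `p ≠ q`). -/
def ShrubStrictAnc (T : RBTree V) (p q : Finset V) : Prop :=
  p ≠ q ∧ ∃ u ∈ p, T.StrictAnc u (T.base q)

/-- Weak ancestor relation in the shrub. -/
def ShrubAnc (T : RBTree V) (p q : Finset V) : Prop :=
  p = q ∨ T.ShrubStrictAnc p q

/-- A maximum path decomposition w.r.t. a leaf assignment: a path decomposition in
which each internal vertex lies on the same path as a child of maximal heap size. -/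
def IsMaxPathDecomp (T : RBTree V) (A : T.LeafAssignment) (P : Finset (Finset V)) : Prop :=
  T.IsPathDecomp P ∧
    ∀ p ∈ P, ∀ v ∈ p, ∀ c ∈ T.children v, c ∈ p →
      ∀ c' ∈ T.children v, (T.heap A c').card ≤ (T.heap A c).card

/-- A path `p` is short if `|p| < sqrt(|H_p|)/100`. -/
def IsShort (T : RBTree V) (A : T.LeafAssignment) (p : Finset V) : Prop :=
  (p.card : ℝ) < Real.sqrt ((T.pathHeap A p).card) / 100

/-- The tall support chain of a path `p`: the maximal chain of tall paths in the shrub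
starting at the parent of `p` and going up. -/
def TallChain (T : RBTree V) (A : T.LeafAssignment) (P : Finset (Finset V)) (p : Finset V) :
    Finset (Finset V) :=
  P.filter (fun q => T.ShrubStrictAnc q p ∧
    ∀ r ∈ P, T.ShrubStrictAnc r p → T.ShrubAnc q r → ¬ T.IsShort A r)

/-- A short path is supported if at least `|H_p|/100` of the vertices of `H_p` lie on
paths of its tall support chain. -/
def IsSupported (T : RBTree V) (A : T.LeafAssignment) (P : Finset (Finset V))
    (p : Finset V) : Prop :=
  ((T.pathHeap A p).card : ℝ) / 100 ≤
    (((T.pathHeap A p).filter (fun v => ∃ q ∈ T.TallChain A P p, v ∈ q)).card : ℝ)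

/-- The reduced heap `H̃_p`: vertices of `H_p` not lying on the tall support chain. -/
def redHeap (T : RBTree V) (A : T.LeafAssignment) (P : Finset (Finset V))
    (p : Finset V) : Finset V :=
  (T.pathHeap A p).filter (fun v => ∀ q ∈ T.TallChain A P p, v ∉ q)

/-- `q` is the parent of the unsupported short path `p` in the shrub forest of
unsupported short paths: `q` is the first short path on the chain of strict shrub
ancestors of `p`. -/
def ForestParent (T : RBTree V) (A : T.LeafAssignment) (P : Finset (Finset V))
    (q p : Finset V) : Prop :=
  q ∈ P ∧ p ∈ P ∧ T.IsShort A q ∧ T.IsShort A p ∧ ¬ T.IsSupported A P p ∧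
    T.ShrubStrictAnc q p ∧
    ∀ r ∈ P, T.ShrubStrictAnc r p → T.ShrubStrictAnc q r → ¬ T.IsShort A r

/-- `U` is the connected component of the shrub forest of unsupported short paths
rooted at the supported short path `r`. -/
def IsComponent (T : RBTree V) (A : T.LeafAssignment) (P : Finset (Finset V))
    (U : Finset (Finset V)) (r : Finset V) : Prop :=
  U ⊆ P ∧ r ∈ U ∧ T.IsShort A r ∧ T.IsSupported A P r ∧
    (∀ p ∈ U, T.IsShort A p) ∧
    (∀ p ∈ U, p ≠ r → ¬ T.IsSupported A P p) ∧
    (∀ p ∈ U, p ≠ r → ∃ q ∈ U, T.ForestParent A P q p) ∧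
    (∀ q ∈ U, ∀ p ∈ P, T.ForestParent A P q p → p ∈ U)

/-- `q` lies in the subtree of the shrub forest rooted at `p`. -/
def ForestDesc (T : RBTree V) (A : T.LeafAssignment) (P : Finset (Finset V))
    (p q : Finset V) : Prop :=
  Relation.ReflTransGen (fun a b => T.ForestParent A P a b) p q

/-- `U_p`: the nodes of `U` in the subtree of the shrub forest rooted at `p`. -/
def usub (T : RBTree V) (A : T.LeafAssignment) (P : Finset (Finset V))
    (U : Finset (Finset V)) (p : Finset V) : Finset (Finset V) :=
  U.filter (fun q => T.ForestDesc A P p q)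

/-- The children of `p` in the shrub forest (within `U`). -/
def forestChildren (T : RBTree V) (A : T.LeafAssignment) (P : Finset (Finset V))
    (U : Finset (Finset V)) (p : Finset V) : Finset (Finset V) :=
  U.filter (fun q => T.ForestParent A P p q)

/-- The residue `R_p = |H̃_p| − Σ_{q child of p} |H̃_q|`. -/
def residue (T : RBTree V) (A : T.LeafAssignment) (P : Finset (Finset V))
    (U : Finset (Finset V)) (p : Finset V) : ℤ :=
  ((T.redHeap A P p).card : ℤ) -
    ∑ q ∈ T.forestChildren A P U p, ((T.redHeap A P q).card : ℤ)

/-- `R⁺_p = max(R_p, 0)`. -/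
def resPlus (T : RBTree V) (A : T.LeafAssignment) (P : Finset (Finset V))
    (U : Finset (Finset V)) (p : Finset V) : ℤ :=
  max (T.residue A P U p) 0

/-- The weight `W_p = Σ_{q ∈ U_p} R⁺_q`. -/
def weight (T : RBTree V) (A : T.LeafAssignment) (P : Finset (Finset V))
    (U : Finset (Finset V)) (p : Finset V) : ℤ :=
  ∑ q ∈ T.usub A P U p, T.resPlus A P U q

end RBTree

namespace RBTree

variable {V : Type} [Fintype V] [DecidableEq V]

lemma parentIter_add (T : RBTree V) (m n : ℕ) (v : V) :
    T.parentIter (m + n) v = (T.parentIter m v).bind (T.parentIter n) := by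
  induction n with
  | zero => cases T.parentIter m v <;> simp [parentIter]
  | succ n ih =>
    rw [← add_assoc, parentIter, ih, Option.bind_assoc]
    rfl

lemma Anc.trans {T : RBTree V} {a b c : V} (hab : T.Anc a b) (hbc : T.Anc b c) :
    T.Anc a c := by
  obtain ⟨m, hm⟩ := hab
  obtain ⟨n, hn⟩ := hbc
  exact ⟨n + m, by rw [parentIter_add, hn, Option.bind_some, hm]⟩

lemma mem_children {T : RBTree V} {c v : V} : c ∈ T.children v ↔ T.parent c = some v := by
  simp [children]

lemma anc_of_mem_children {T : RBTree V} {c v : V} (h : c ∈ T.children v) : T.Anc v c :=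
  ⟨1, by simpa [parentIter] using mem_children.1 h⟩

lemma depth_eq_of_parentIter {T : RBTree V} {n : ℕ} {u v : V}
    (h : T.parentIter n v = some u) : T.depth v = T.depth u + n := by
  induction n generalizing u with
  | zero => simp_all [parentIter]
  | succ n ih =>
    obtain ⟨x, hx, hxu⟩ := Option.bind_eq_some_iff.1 h
    have := ih hx
    have := T.depth_parent x u hxu
    omega

lemma Anc.eq_of_depth_eq {T : RBTree V} {a b l : V} (ha : T.Anc a l) (hb : T.Anc b l)
    (h : T.depth a = T.depth b) : a = b := by
  obtain ⟨m, hm⟩ := ha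
  obtain ⟨n, hn⟩ := hb
  have h₁ := depth_eq_of_parentIter hm
  have h₂ := depth_eq_of_parentIter hn
  obtain rfl : m = n := by omega
  exact Option.some.inj (hm.symm.trans hn)

lemma StrictAnc.eq_or_strictAnc_of_mem_children {T : RBTree V} {x u v : V}
    (h : T.StrictAnc x v) (hv : v ∈ T.children u) : x = u ∨ T.StrictAnc x u := by
  obtain ⟨n, hn, hx⟩ := h
  obtain ⟨m, rfl⟩ : ∃ m, n = 1 + m := ⟨n - 1, by omega⟩
  have h₁ : T.parentIter 1 v = some u := by simpa [parentIter] using mem_children.1 hv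
  rw [parentIter_add, h₁, Option.bind_some] at hx
  rcases Nat.eq_zero_or_pos m with rfl | hm
  · exact Or.inl (Option.some.inj hx).symm
  · exact Or.inr ⟨m, hm, hx⟩

lemma StrictAnc.exists_child_anc {T : RBTree V} {x u : V} (h : T.StrictAnc x u) :
    ∃ c ∈ T.children x, T.Anc c u := by
  obtain ⟨n, hn, hx⟩ := h
  obtain ⟨m, rfl⟩ : ∃ m, n = m + 1 := ⟨n - 1, by omega⟩
  obtain ⟨c, hc, hcx⟩ := Option.bind_eq_some_iff.1 hx
  exact ⟨c, mem_children.2 hcx, m, hc⟩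

lemma mem_heap {T : RBTree V} {A : T.LeafAssignment} {x v : V} :
    x ∈ T.heap A v ↔ T.StrictAnc x v ∧ ∃ l ∈ A.χ x, T.Anc v l := by
  simp only [heap, subtreeLeaves, Finset.Nonempty, Finset.mem_filter, Finset.mem_univ,
    true_and, Finset.mem_inter]
  exact and_congr_right fun _ => exists_congr fun l =>
    ⟨fun h => ⟨h.1, h.2.2⟩, fun h => ⟨h.1, A.mem_leaf x l h.1, h.2⟩⟩

lemma heap_subset_insert_heap {T : RBTree V} (A : T.LeafAssignment) {u v : V}
    (hv : v ∈ T.children u) : T.heap A v ⊆ insert u (T.heap A u) := by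
  intro x hx
  obtain ⟨hxv, l, hl, hvl⟩ := mem_heap.1 hx
  rw [Finset.mem_insert, mem_heap]
  exact (hxv.eq_or_strictAnc_of_mem_children hv).imp_right
    fun h => ⟨h, l, hl, (anc_of_mem_children hv).trans hvl⟩

lemma heap_inter_heap_subset {T : RBTree V} (A : T.LeafAssignment) {u v w : V}
    (hv : v ∈ T.children u) (hw : w ∈ T.children u) (hvw : v ≠ w) :
    T.heap A v ∩ T.heap A w ⊆ {u} := by
  intro x hx
  obtain ⟨hxv, hxw⟩ := Finset.mem_inter.1 hx
  obtain ⟨hxv, l, hl, hvl⟩ := mem_heap.1 hxv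
  obtain ⟨-, l', hl', hwl⟩ := mem_heap.1 hxw
  rw [Finset.mem_singleton]
  refine (hxv.eq_or_strictAnc_of_mem_children hv).resolve_right fun hxu => hvw ?_
  obtain ⟨c, hc, hcu⟩ := hxu.exists_child_anc
  obtain rfl : l = l' := (A.unique_child x c hc).unique
    ⟨hl, hcu.trans ((anc_of_mem_children hv).trans hvl)⟩
    ⟨hl', hcu.trans ((anc_of_mem_children hw).trans hwl)⟩
  refine hvl.eq_of_depth_eq hwl ?_
  rw [T.depth_parent v u (mem_children.1 hv), T.depth_parent w u (mem_children.1 hw)]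

end RBTree

open RBTree in
/-- if `u` has two children `v` and `w`, then
`H_v ∪ H_w ⊆ H_u ∪ {u}`, `H_v ∩ H_w ⊆ {u}`, and `|H_u| ≥ |H_v| + |H_w| − 2`. -/
theorem heap_children_union_inter {V : Type} [Fintype V] [DecidableEq V]
    (T : RBTree V) (A : T.LeafAssignment) (u v w : V)
    (hv : v ∈ T.children u) (hw : w ∈ T.children u) (hvw : v ≠ w) :
    T.heap A v ∪ T.heap A w ⊆ insert u (T.heap A u) ∧
      T.heap A v ∩ T.heap A w ⊆ {u} ∧
      ((T.heap A v).card : ℤ) + ((T.heap A w).card : ℤ) - 2 ≤ ((T.heap A u).card : ℤ) := by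
  have hunion := Finset.union_subset (heap_subset_insert_heap A hv) (heap_subset_insert_heap A hw)
  have hinter := heap_inter_heap_subset A hv hw hvw
  refine ⟨hunion, hinter, ?_⟩
  have h₁ := (Finset.card_le_card hunion).trans (Finset.card_insert_le _ _)
  have h₂ := Finset.card_le_card hinter
  rw [Finset.card_singleton] at h₂
  have h₃ := Finset.card_union_add_card_inter (T.heap A v) (T.heap A w)
  omega
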